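/- With the labeling F as above, in every interval [x,y] of R_n there exists exactly one maximal chain x = x_0 < x_1 < ... < x_k = y whose label sequence F(x_0,x_1) ≤ F(x_1,x_2) ≤ ... ≤ F(x_{k-1},x_k) is weakly increasing. -/

import Mathlib

open Finset

variable {n : ℕ}

/-- An element of the rook monoid `R_n` in one-line notation: a sequence of
entries in `{0,...,n}` whose nonzero entries are pairwise distinct. -/
def IsRook (n : ℕ) (a : Fin n → ℕ) : Prop :=
  (∀ i, a i ≤ n) ∧ ∀ i j, a i ≠ 0 → a i = a j → i = j

/-- number of inversions -/
def rinv (a : Fin n → ℕ) : ℕ :=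
  ((univ ×ˢ univ).filter fun p : Fin n × Fin n => p.1 < p.2 ∧ a p.2 < a p.1).card

/-- number of coinversion pairs -/
def rcoinv (a : Fin n → ℕ) : ℕ :=
  ((univ ×ˢ univ).filter fun p : Fin n × Fin n => p.1 < p.2 ∧ 0 < a p.1 ∧ a p.1 < a p.2).card

/-- the length function ℓ -/
def rlen (a : Fin n → ℕ) : ℕ := (∑ i, a i) + rinv a

/-- type 1 generating relation: increase a single entry -/
def Step1 (a b : Fin n → ℕ) : Prop := ∃ i, a i < b i ∧ ∀ j, j ≠ i → a j = b j

/-- type 2 generating relation: swap two entries, larger one first -/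
def Step2 (a b : Fin n → ℕ) : Prop :=
  ∃ i j, i < j ∧ a i < a j ∧ b i = a j ∧ b j = a i ∧ ∀ k, k ≠ i → k ≠ j → a k = b k

/-- the Bruhat-Chevalley-Renner order on `R_n` -/
def RookLe (n : ℕ) (a b : Fin n → ℕ) : Prop :=
  Relation.ReflTransGen (fun x y => IsRook n x ∧ IsRook n y ∧ (Step1 x y ∨ Step2 x y)) a b

def RookLt (n : ℕ) (a b : Fin n → ℕ) : Prop := RookLe n a b ∧ a ≠ b

/-- covering relation of the Bruhat-Chevalley-Renner order -/
def RookCov (n : ℕ) (a b : Fin n → ℕ) : Prop :=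
  RookLt n a b ∧ ∀ z, RookLt n a z → RookLt n z b → False

/-- the edge labeling `F` on covering relations -/
noncomputable def Flabel (a b : Fin n → ℕ) : ℕ × ℕ := by
  classical
  exact if h : ∃ i, a i < b i ∧ ∀ j, j ≠ i → a j = b j then (a h.choose, b h.choose)
  else if h2 : ∃ p : Fin n × Fin n, p.1 < p.2 ∧ a p.1 < a p.2 ∧ b p.1 = a p.2 ∧ b p.2 = a p.1 ∧
      ∀ k, k ≠ p.1 → k ≠ p.2 → a k = b k then (a h2.choose.1, a h2.choose.2)
  else (0, 0)

/-- lexicographic (strict) order on labels -/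
def pairLt (p q : ℕ × ℕ) : Prop := p.1 < q.1 ∨ (p.1 = q.1 ∧ p.2 < q.2)

def pairLe (p q : ℕ × ℕ) : Prop := p = q ∨ pairLt p q

/-- lexicographic comparison of label sequences -/
def lexLe (l m : List (ℕ × ℕ)) : Prop := l = m ∨ List.Lex pairLt l m

/-- the Jordan-Hölder sequence of labels of a chain -/
noncomputable def labels (c : List (Fin n → ℕ)) : List (ℕ × ℕ) :=
  List.zipWith Flabel c c.tail

/-- a maximal chain in the interval `[x,y]` -/
def RookMaxChain (n : ℕ) (x y : Fin n → ℕ) (c : List (Fin n → ℕ)) : Prop :=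
  c.Chain' (RookCov n) ∧ c.head? = some x ∧ c.getLast? = some y

/-- The rank function of a rook: the number of entries at least `k` among the first `i`. -/
def rank (x : Fin n → ℕ) (k : ℕ) : ℕ → ℕ
  | 0 => 0
  | i + 1 => rank x k i + if ∃ h : i < n, k ≤ x ⟨i, h⟩ then 1 else 0

/-- `y` arises from `x` by bringing the value `b` to position `p`. The value `b` sits at position
`q` of `x`, where `q = n` means that it does not occur; so this is a step of type 2 when `q < n`
and a step of type 1 when `q = n`. -/
structure Move (x y : Fin n → ℕ) (p : Fin n) (q b : ℕ) : Prop where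
  lt_pos : p.val < q
  pos_le : q ≤ n
  lt_val : x p < b
  val_le : b ≤ n
  pos : ∀ k : Fin n, x k = b ↔ k.val = q
  eq : ∀ k : Fin n, y k = if k = p then b else if k.val = q then x p else x k

/-- The condition under which a `Move` is a covering relation. -/
structure Tight (x : Fin n → ℕ) (p : Fin n) (q b : ℕ) : Prop where
  between : ∀ k : Fin n, p < k → k.val < q → x p ≤ x k → b < x k
  occurs : q = n → ∀ c, x p < c → c < b → ∃ k, x k = c

theorem exists_move (x : Fin n → ℕ) (p : Fin n) (q b : ℕ) (h1 : p.val < q) (h2 : q ≤ n)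
    (h3 : x p < b) (h4 : b ≤ n) (h5 : ∀ k : Fin n, x k = b ↔ k.val = q) :
    ∃ y, Move x y p q b :=
  ⟨_, h1, h2, h3, h4, h5, fun _ => rfl⟩

theorem Move.isRook {x y : Fin n → ℕ} {p : Fin n} {q b : ℕ} (h : Move x y p q b)
    (hx : IsRook n x) : IsRook n y := by
  obtain ⟨h1, h2, h3, h4, h5, h6⟩ := h
  obtain ⟨hx1, hx2⟩ := hx
  refine ⟨fun i => ?_, fun i j hi hij => ?_⟩
  · rw [h6]; split_ifs
    · exact h4
    · exact hx1 _
    · exact hx1 _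
  · have e1 := h6 i
    have e2 := h6 j
    have f1 := h5 i
    have f2 := h5 j
    have g1 := hx2 i j
    have g2 := hx2 i p
    have g3 := hx2 p j
    have := @Fin.ext_iff n i j
    grind

theorem Move.step {x y : Fin n → ℕ} {p : Fin n} {q b : ℕ} (h : Move x y p q b) :
    Step1 x y ∨ Step2 x y := by
  obtain ⟨h1, h2, h3, h4, h5, h6⟩ := h
  rcases h2.lt_or_eq with hq | hq
  · right
    have := h5 ⟨q, hq⟩
    have := h6 ⟨q, hq⟩
    refine ⟨p, ⟨q, hq⟩, h1, by grind, by grind, by grind, fun k hk1 hk2 => ?_⟩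
    have : k.val ≠ q := fun h => hk2 (Fin.ext h)
    grind
  · left
    refine ⟨p, by grind, fun k hk => ?_⟩
    have := k.isLt
    grind

theorem Move.le {x y : Fin n → ℕ} {p : Fin n} {q b : ℕ} (h : Move x y p q b)
    (hx : IsRook n x) : RookLe n x y :=
  Relation.ReflTransGen.single ⟨hx, h.isRook hx, h.step⟩

theorem exists_move_of_step {x y : Fin n → ℕ} (hx : IsRook n x) (hy : IsRook n y)
    (h : Step1 x y ∨ Step2 x y) : ∃ p q b, Move x y p q b := by
  rcases h with ⟨i, hi, h⟩ | ⟨i, j, hij, hlt, h1, h2, h⟩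
  · refine ⟨i, n, y i, i.isLt, le_rfl, hi, hy.1 i, fun k => ?_, fun k => ?_⟩
    · have := k.isLt
      have := hy.2 i k
      have := h k
      grind
    · have := k.isLt
      have := h k
      grind
  · refine ⟨i, j, x j, hij, j.isLt.le, hlt, hx.1 j, fun k => ?_, fun k => ?_⟩
    · have := hx.2 j k
      rw [← Fin.ext_iff]
      grind
    · simp only [← Fin.ext_iff]
      have := h k
      grind

theorem RookLe.head {x y : Fin n → ℕ} (h : RookLe n x y) (hne : x ≠ y) :
    IsRook n x ∧ ∃ v p q b, Move x v p q b ∧ RookLe n v y := by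
  rcases Relation.ReflTransGen.cases_head h with rfl | ⟨v, ⟨hx, hv, hs⟩, hvy⟩
  · exact absurd rfl hne
  · obtain ⟨p, q, b, hm⟩ := exists_move_of_step hx hv hs
    exact ⟨hx, v, p, q, b, hm, hvy⟩

theorem Move.rank_eq {x y : Fin n → ℕ} {p : Fin n} {q b : ℕ} (h : Move x y p q b) (k i : ℕ)
    (hi : i ≤ n) :
    rank y k i = rank x k i + if p.val < i ∧ i ≤ q ∧ x p < k ∧ k ≤ b then 1 else 0 := by
  obtain ⟨h1, h2, h3, h4, h5, h6⟩ := h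
  induction i with
  | zero => simp [rank]
  | succ i ih =>
    have hi' : i < n := hi
    simp only [rank, hi', exists_true_left, ih hi'.le]
    have e := h6 ⟨i, hi'⟩
    have f := h5 ⟨i, hi'⟩
    have g : (⟨i, hi'⟩ : Fin n) = p ↔ i = p.val := Fin.ext_iff
    by_cases hp : i = p.val
    · have := g.2 hp
      grind
    · have : ¬ (⟨i, hi'⟩ : Fin n) = p := fun h => hp (g.1 h)
      grind

theorem RookLe.rank_le {x y : Fin n → ℕ} (h : RookLe n x y) (k i : ℕ) (hi : i ≤ n) :
    rank x k i ≤ rank y k i := by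
  induction h with
  | refl => exact le_rfl
  | tail _ hs ih =>
    obtain ⟨p, q, b, hm⟩ := exists_move_of_step hs.1 hs.2.1 hs.2.2
    rw [hm.rank_eq k i hi]
    omega

/-- A strictly monotone weight on the rook monoid. -/
def weight (x : Fin n → ℕ) : ℕ := ∑ i ∈ range (n + 1), ∑ k ∈ range (n + 1), rank x k i

theorem RookLe.weight_le {x y : Fin n → ℕ} (h : RookLe n x y) : weight x ≤ weight y := by
  refine sum_le_sum fun i hi => sum_le_sum fun k _ => h.rank_le k i ?_
  simp only [mem_range] at hi
  omega

theorem Move.weight_lt {x y : Fin n → ℕ} {p : Fin n} {q b : ℕ} (h : Move x y p q b)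
    (hx : IsRook n x) : weight x < weight y := by
  have hle : ∀ i ∈ range (n + 1), ∀ k, rank x k i ≤ rank y k i := fun i hi k =>
    (h.le hx).rank_le k i (Nat.lt_succ_iff.1 (mem_range.1 hi))
  have hq : q ∈ range (n + 1) := mem_range.2 (Nat.lt_succ_iff.2 h.pos_le)
  refine sum_lt_sum (fun i hi => sum_le_sum fun k _ => hle i hi k) ⟨q, hq, ?_⟩
  refine sum_lt_sum (fun k _ => hle q hq k) ⟨b, mem_range.2 (Nat.lt_succ_iff.2 h.val_le), ?_⟩
  rw [h.rank_eq b q h.pos_le, if_pos ⟨h.lt_pos, le_rfl, h.lt_val, le_rfl⟩]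
  omega

theorem RookLe.weight_lt {x y : Fin n → ℕ} (h : RookLe n x y) (hne : x ≠ y) :
    weight x < weight y := by
  obtain ⟨hx, v, p, q, b, hm, hv⟩ := h.head hne
  exact (hm.weight_lt hx).trans_le hv.weight_le

theorem Move.ne {x y : Fin n → ℕ} {p : Fin n} {q b : ℕ} (h : Move x y p q b) : x ≠ y := by
  intro he
  have := h.eq p
  have := h.lt_val
  subst he
  simp_all

theorem Move.flabel {x y : Fin n → ℕ} {p : Fin n} {q b : ℕ} (h : Move x y p q b) :
    Flabel x y = (x p, b) := by
  obtain ⟨h1, h2, h3, h4, h5, h6⟩ := h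
  have hyp : y p = b := by simp [h6]
  unfold Flabel
  split_ifs with g1 g2
  · obtain ⟨s1, s2⟩ := g1.choose_spec
    have : g1.choose = p := by
      by_contra hne
      have := s2 p (Ne.symm hne)
      omega
    rw [this, hyp]
  · obtain ⟨s1, s2, s3, s4, s5⟩ := g2.choose_spec
    generalize g2.choose = r at s1 s2 s3 s4 s5
    obtain ⟨i, j⟩ := r
    simp only at s1 s2 s3 s4 s5 ⊢
    have e1 := h6 i
    have e2 := h6 j
    have f1 := h5 i
    have f2 := h5 j
    have hp := s5 p
    have : i = p := by grind
    subst this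
    grind
  · exfalso
    rcases h2.lt_or_eq with hq | hq
    · refine g2 ⟨(p, ⟨q, hq⟩), h1, ?_⟩
      have := h5 ⟨q, hq⟩
      have := h6 ⟨q, hq⟩
      refine ⟨by grind, by grind, by grind, fun k hk1 hk2 => ?_⟩
      have : k.val ≠ q := fun h => hk2 (Fin.ext h)
      grind
    · refine g1 ⟨p, by grind, fun k hk => ?_⟩
      have := k.isLt
      grind

theorem Move.cov {x y : Fin n → ℕ} {p : Fin n} {q b : ℕ} (h : Move x y p q b)
    (ht : Tight x p q b) (hx : IsRook n x) : RookCov n x y := by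
  refine ⟨⟨h.le hx, h.ne⟩, fun z hxz hzy => ?_⟩
  obtain ⟨-, v, p', q', b', hm, hv⟩ := hxz.1.head hxz.2
  have hvy : RookLe n v y := hv.trans hzy.1
  have c1 := hvy.rank_le b' (p' + 1) p'.isLt
  have c2 := hvy.rank_le (x p' + 1) q' hm.pos_le
  rw [h.rank_eq _ _ p'.isLt, hm.rank_eq _ _ p'.isLt] at c1
  rw [h.rank_eq _ _ hm.pos_le, hm.rank_eq _ _ hm.pos_le] at c2
  have a1 := hm.lt_pos
  have a2 := hm.lt_val
  rw [if_pos (by omega)] at c1 c2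
  have d1 : p.val < p' + 1 ∧ p' + 1 ≤ q ∧ x p < b' ∧ b' ≤ b := by
    by_contra hc; rw [if_neg hc] at c1; omega
  have d2 : p.val < q' ∧ q' ≤ q ∧ x p < x p' + 1 ∧ x p' + 1 ≤ b := by
    by_contra hc; rw [if_neg hc] at c2; omega
  have hp : p' = p := by
    by_contra hne
    have : p.val ≠ p'.val := fun h => hne (Fin.ext h.symm)
    have := ht.between p' (Fin.lt_def.2 (by omega)) (by omega) (by omega)
    omega
  subst hp
  have hb : b' = b ∧ q' = q := by
    rcases hm.pos_le.lt_or_eq with hq | hq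
    · have e : x ⟨q', hq⟩ = b' := (hm.pos ⟨q', hq⟩).2 rfl
      have hqq : q' = q := by
        by_contra hne
        have := ht.between ⟨q', hq⟩ (Fin.lt_def.2 a1) (by simp only; omega) (by omega)
        omega
      exact ⟨e ▸ (h.pos ⟨q', hq⟩).2 hqq, hqq⟩
    · have hqn : q = n := le_antisymm h.pos_le (by omega)
      refine ⟨?_, by omega⟩
      by_contra hne
      obtain ⟨k, hk⟩ := ht.occurs hqn b' a2 (by omega)
      have := (hm.pos k).1 hk
      have := k.isLt
      omega
  obtain ⟨rfl, rfl⟩ := hb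
  have : v = y := by
    funext k
    rw [h.eq, hm.eq]
  subst this
  have := hv.weight_le
  have := hzy.1.weight_lt hzy.2
  omega

theorem pairLt_trans {l m r : ℕ × ℕ} (h : pairLt l m) (h' : pairLt m r) : pairLt l r := by
  unfold pairLt at *; omega

theorem pairLt_trichotomy (l m : ℕ × ℕ) : pairLt l m ∨ l = m ∨ pairLt m l := by
  unfold pairLt; rw [Prod.ext_iff]; omega

theorem pairLt_of_pairLe_of_pairLt {l m r : ℕ × ℕ} (h : pairLe l m) (h' : pairLt m r) :
    pairLt l r := by
  rcases h with rfl | h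
  · exact h'
  · exact pairLt_trans h h'

theorem pairLt_of_pairLt_of_pairLe {l m r : ℕ × ℕ} (h : pairLt l m) (h' : pairLe m r) :
    pairLt l r := by
  rcases h' with rfl | h'
  · exact h
  · exact pairLt_trans h h'

theorem pairLe_trans {l m r : ℕ × ℕ} (h : pairLe l m) (h' : pairLe m r) : pairLe l r := by
  rcases h with rfl | h
  · exact h'
  · exact Or.inr (pairLt_of_pairLt_of_pairLe h h')

theorem pairLt_wellFounded : WellFounded pairLt := by
  refine Subrelation.wf (r := Prod.Lex (· < ·) (· < ·)) ?_
    (WellFounded.prod_lex wellFounded_lt wellFounded_lt)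
  intro l m h
  exact Prod.lex_def.2 h

theorem Move.exists_tight {x y : Fin n → ℕ} {p : Fin n} {q b : ℕ} (h : Move x y p q b)
    (hx : IsRook n x) : ∃ z p' q' b', Move x z p' q' b' ∧ Tight x p' q' b' ∧
      pairLe (x p', b') (x p, b) ∧ RookLe n z y := by
  induction hN : b + (n - p.val) using Nat.strong_induction_on generalizing y p q b with
  | _ N ih =>
  by_cases ht : Tight x p q b
  · exact ⟨y, p, q, b, h, ht, Or.inl rfl, Relation.ReflTransGen.refl⟩
  have reduce : ∀ (v : Fin n → ℕ) (p' : Fin n) (q' b' : ℕ), Move x v p' q' b' → RookLe n v y →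
      b' + (n - p'.val) < b + (n - p.val) → pairLe (x p', b') (x p, b) →
      ∃ z p' q' b', Move x z p' q' b' ∧ Tight x p' q' b' ∧
        pairLe (x p', b') (x p, b) ∧ RookLe n z y := by
    intro v p' q' b' hm hv hlt hle
    obtain ⟨z, p'', q'', b'', m1, m2, m3, m4⟩ := ih _ (hN ▸ hlt) hm rfl
    exact ⟨z, p'', q'', b'', m1, m2, pairLe_trans m3 hle, m4.trans hv⟩
  obtain ⟨h1, h2, h3, h4, h5, h6⟩ := id h
  have hcases : (∃ k : Fin n, p < k ∧ k.val < q ∧ x p ≤ x k ∧ x k ≤ b) ∨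
      (q = n ∧ ∃ c, x p < c ∧ c < b ∧ ∀ k, x k ≠ c) := by
    by_contra hc
    push Not at hc
    exact ht ⟨hc.1, hc.2⟩
  rcases hcases with ⟨k, hpk, hkq, hle, hkb⟩ | ⟨rfl, c, hc1, hc2, hc3⟩
  · have hpk' := Fin.lt_def.1 hpk
    have hne : x k ≠ b := fun e => by have := (h5 k).1 e; omega
    rcases hle.lt_or_eq with hlt | heq
    · obtain ⟨v, hv⟩ := exists_move x p k (x k) hpk' k.isLt.le hlt (by omega) (fun j => by
        rw [← Fin.ext_iff]
        have := hx.2 j k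
        grind)
      obtain ⟨w, hw⟩ := exists_move v k q b hkq h2 (by have := hv.eq k; grind) h4 (fun j => by
        have := hv.eq j; have := h5 j; grind)
      have hwy : Move w y p k b := by
        have v1 := hv.eq
        have w1 := hw.eq
        refine ⟨hpk', k.isLt.le, by grind, h4, fun j => ?_, fun j => ?_⟩
        · have := hx.2 j k
          have := @Fin.ext_iff n j k
          have := @Fin.ext_iff n j p
          grind
        · have := hx.2 j k
          have := @Fin.ext_iff n j k
          have := @Fin.ext_iff n j p
          grind
      have hvr := hv.isRook hx
      refine reduce v p k (x k) hv ((hw.le hvr).trans (hwy.le (hw.isRook hvr))) (by omega) ?_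
      right; right; exact ⟨rfl, by simp only; omega⟩
    · obtain ⟨v, hv⟩ := exists_move x k q b hkq h2 (by omega) h4 h5
      have hvy : Move v y p k b := by
        have v1 := hv.eq
        refine ⟨hpk', k.isLt.le, by grind, h4, fun j => ?_, fun j => ?_⟩
        · have := @Fin.ext_iff n j k
          have := @Fin.ext_iff n j p
          grind
        · have := @Fin.ext_iff n j k
          have := @Fin.ext_iff n j p
          grind
      refine reduce v k q b hv (hvy.le (hv.isRook hx)) (by omega) ?_
      rw [heq]; exact Or.inl rfl
  · obtain ⟨v, hv⟩ := exists_move x p q c h1 h2 hc1 (by omega) (fun j => by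
      have := hc3 j; have := j.isLt; omega)
    have hvy : Move v y p q b := by
      have v1 := hv.eq
      refine ⟨h1, h2, by grind, h4, fun j => ?_, fun j => ?_⟩
      · have := j.isLt
        grind
      · have := j.isLt
        grind
    refine reduce v p q c hv (hvy.le (hv.isRook hx)) (by omega) ?_
    right; right; exact ⟨rfl, hc2⟩

theorem RookCov.exists_move {x y : Fin n → ℕ} (h : RookCov n x y) :
    IsRook n x ∧ IsRook n y ∧ ∃ p q b, Move x y p q b ∧ Tight x p q b := by
  obtain ⟨hx, v, p, q, b, hm, hv⟩ := h.1.1.head h.1.2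
  obtain ⟨z, p', q', b', m1, m2, -, m4⟩ := hm.exists_tight hx
  have hzy : z = y := by
    by_contra hne
    exact h.2 z ⟨m1.le hx, m1.ne⟩ ⟨m4.trans hv, hne⟩
  subst hzy
  exact ⟨hx, m1.isRook hx, p', q', b', m1, m2⟩

theorem Move.commute {x z w : Fin n → ℕ} {p p' : Fin n} {q q' b b' : ℕ}
    (h : Move x z p q b) (h' : Move z w p' q' b') (hp : p' ≠ p) (hq : p'.val ≠ q)
    (hb : b' ≠ b) (ha : b' ≠ x p) :
    ∃ u, Move x u p' q' b' ∧ Move u w p q b := by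
  obtain ⟨h1, h2, h3, h4, h5, h6⟩ := h
  obtain ⟨g1, g2, g3, g4, g5, g6⟩ := h'
  have hpv : p'.val ≠ p.val := fun e => hp (Fin.ext e)
  have hzp : z p' = x p' := by grind
  have hqq : q' ≠ q ∨ q' = n := by
    by_contra hc
    push Not at hc
    have := g5 ⟨q', by omega⟩
    have := h6 ⟨q', by omega⟩
    grind
  have hqp : q' ≠ p.val := by
    have := g5 p
    grind
  obtain ⟨u, hu⟩ := exists_move x p' q' b' g1 g2 (by omega) g4 (fun k => by
    have := g5 k; have := h5 k; grind)
  have u1 := hu.eq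
  refine ⟨u, hu, h1, h2, by grind, h4, fun k => ?_, fun k => ?_⟩
  · have := k.isLt
    have := @Fin.ext_iff n k p
    have := @Fin.ext_iff n k p'
    grind
  · have := k.isLt
    have := @Fin.ext_iff n k p
    have := @Fin.ext_iff n k p'
    grind

theorem Move.exchange {x z w : Fin n → ℕ} {p p' : Fin n} {q q' b b' : ℕ} (hx : IsRook n x)
    (h : Move x z p q b) (h' : Move z w p' q' b') (hlt : pairLt (z p', b') (x p, b)) :
    ∃ u r s c r' s' c', Move x u r s c ∧ Move u w r' s' c' ∧ pairLt (x r, c) (x p, b) := by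
  have hz := h.isRook hx
  obtain ⟨h1, h2, h3, h4, h5, h6⟩ := id h
  obtain ⟨g1, g2, g3, g4, g5, g6⟩ := id h'
  have hzp : z p = b := by simp [h6]
  have hpp : p' ≠ p := by rintro rfl; unfold pairLt at hlt; grind
  have hpv : p'.val ≠ p.val := fun e => hpp (Fin.ext e)
  rcases hlt with hlt | ⟨heq, hlt⟩
  · simp only at hlt
    have hpq : p'.val ≠ q := by intro e; grind
    have hxp : z p' = x p' := by grind
    rw [hxp] at hlt g3
    by_cases hb : b' = b
    · subst hb
      have hq' : q' = p := ((g5 p).1 hzp).symm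
      subst hq'
      obtain ⟨u, hu⟩ := exists_move x p' p (x p) g1 p.isLt.le hlt (hx.1 p) (fun k => by
        have := hx.2 k p; rw [← Fin.ext_iff]; grind)
      refine ⟨u, p', p, x p, p', q, b', hu, ?_, Or.inl hlt⟩
      have u1 := hu.eq
      refine ⟨by omega, h2, by grind, h4, fun k => ?_, fun k => ?_⟩
      all_goals
        have := k.isLt
        have := @Fin.ext_iff n k p
        have := @Fin.ext_iff n k p'
        grind
    by_cases ha : b' = x p
    · subst ha
      have hq' : q' = q := by
        rcases h2.lt_or_eq with hq | hq
        · have := g5 ⟨q, hq⟩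
          have := h6 ⟨q, hq⟩
          grind
        · rcases g2.lt_or_eq with hq' | hq'
          · exfalso
            have e := (g5 ⟨q', hq'⟩).2 rfl
            have := h6 ⟨q', hq'⟩
            have := hx.2 ⟨q', hq'⟩ p
            grind
          · omega
      subst hq'
      rcases lt_or_gt_of_ne hpv with hlt' | hgt
      · obtain ⟨u, hu⟩ := exists_move x p' p (x p) hlt' p.isLt.le hlt (hx.1 p) (fun k => by
          have := hx.2 k p; rw [← Fin.ext_iff]; grind)
        refine ⟨u, p', p, x p, p, q', b, hu, ?_, Or.inl hlt⟩
        have u1 := hu.eq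
        refine ⟨by omega, h2, by grind, h4, fun k => ?_, fun k => ?_⟩
        all_goals
          have := k.isLt
          have := @Fin.ext_iff n k p
          have := @Fin.ext_iff n k p'
          grind
      · obtain ⟨u, hu⟩ := exists_move x p' q' b g1 h2 (by omega) h4 h5
        refine ⟨u, p', q', b, p, p', b, hu, ?_, Or.inl hlt⟩
        have u1 := hu.eq
        refine ⟨by omega, p'.isLt.le, by grind, h4, fun k => ?_, fun k => ?_⟩
        all_goals
          have := k.isLt
          have := @Fin.ext_iff n k p
          have := @Fin.ext_iff n k p'
          grind
    · obtain ⟨u, hu, hw⟩ := h.commute h' hpp hpq hb ha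
      exact ⟨u, p', q', b', p, q, b, hu, hw, Or.inl hlt⟩
  · simp only at heq hlt
    have ha : b' ≠ x p := by omega
    by_cases hpq : p'.val = q
    · subst hpq
      obtain ⟨u, hu⟩ := exists_move x p q' b' (by omega) g2 (by omega) g4 (fun k => by
        have := g5 k; have := h5 k; have := h6 k; grind)
      refine ⟨u, p, q', b', p, p', b, hu, ?_, Or.inr ⟨rfl, hlt⟩⟩
      have u1 := hu.eq
      refine ⟨h1, p'.isLt.le, by grind, h4, fun k => ?_, fun k => ?_⟩
      all_goals
        have := k.isLt
        have := @Fin.ext_iff n k p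
        have := @Fin.ext_iff n k p'
        grind
    · obtain ⟨u, hu, hw⟩ := h.commute h' hpp hpq hlt.ne ha
      have : z p' = x p' := by grind
      exact ⟨u, p', q', b', p, q, b, hu, hw, Or.inr ⟨by simp only; omega, hlt⟩⟩

/-- A maximal chain from `x` to `y` with weakly increasing labels. -/
def IncreasingChain (x y : Fin n → ℕ) (c : List (Fin n → ℕ)) : Prop :=
  (c.IsChain (RookCov n) ∧ c.head? = some x ∧ c.getLast? = some y) ∧ (labels c).IsChain pairLe

theorem increasingChain_nil (x y : Fin n → ℕ) : ¬ IncreasingChain x y [] := by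
  simp [IncreasingChain]

theorem increasingChain_singleton {x y z : Fin n → ℕ} :
    IncreasingChain x y [z] ↔ z = x ∧ z = y := by
  simp [IncreasingChain, labels]

theorem increasingChain_cons_cons {x y z z' : Fin n → ℕ} {t : List (Fin n → ℕ)} :
    IncreasingChain x y (z :: z' :: t) ↔ z = x ∧ RookCov n x z' ∧ IncreasingChain z' y (z' :: t) ∧
      ∀ w ∈ t.head?, pairLe (Flabel x z') (Flabel z' w) := by
  cases t with
  | nil => simp [IncreasingChain, labels]; grind
  | cons w t => simp [IncreasingChain, labels]; grind

theorem IncreasingChain.rookLe {x y : Fin n → ℕ} {c : List (Fin n → ℕ)}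
    (h : IncreasingChain x y c) : RookLe n x y := by
  induction c generalizing x with
  | nil => exact absurd h (increasingChain_nil x y)
  | cons z t ih =>
    cases t with
    | nil =>
      obtain ⟨rfl, rfl⟩ := increasingChain_singleton.1 h
      exact Relation.ReflTransGen.refl
    | cons z' t =>
      obtain ⟨rfl, hc, ht, -⟩ := increasingChain_cons_cons.1 h
      exact hc.1.1.trans (ih ht)

theorem IncreasingChain.rank_eq_of_le {x y : Fin n → ℕ} {c : List (Fin n → ℕ)} {k i : ℕ}
    (hi : i ≤ n) (h : IncreasingChain x y c) (hk : ∀ w ∈ c.tail.head?, k ≤ (Flabel x w).1) :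
    rank y k i = rank x k i := by
  induction c generalizing x with
  | nil => exact absurd h (increasingChain_nil x y)
  | cons z t ih =>
    cases t with
    | nil =>
      obtain ⟨rfl, rfl⟩ := increasingChain_singleton.1 h
      rfl
    | cons z' t =>
      obtain ⟨rfl, hc, ht, hl⟩ := increasingChain_cons_cons.1 h
      obtain ⟨-, -, p, q, b, hm, -⟩ := hc.exists_move
      have hk' : k ≤ (Flabel z z').1 := hk z' rfl
      rw [ih ht fun w hw => ?_, hm.rank_eq k i hi, if_neg, add_zero]
      · rw [hm.flabel] at hk'
        simp only at hk'
        omega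
      · rcases hl w hw with he | he | he
        · rwa [← he]
        · exact hk'.trans he.le
        · exact hk'.trans he.1.le

theorem IncreasingChain.rank_eq_of_pairLt {x y : Fin n → ℕ} {c : List (Fin n → ℕ)} {a b i : ℕ}
    (hab : a < b) (hi : i ≤ n) (h : IncreasingChain x y c) (hb : ∀ k : Fin n, x k = b ↔ k.val = i)
    (hc : ∀ w ∈ c.tail.head?, pairLt (a, b) (Flabel x w)) :
    rank y (a + 1) i = rank x (a + 1) i := by
  induction c generalizing x with
  | nil => exact absurd h (increasingChain_nil x y)
  | cons z t ih =>
    cases t with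
    | nil =>
      obtain ⟨rfl, rfl⟩ := increasingChain_singleton.1 h
      rfl
    | cons z' t =>
      have hlab : pairLt (a, b) (Flabel x z') := hc z' rfl
      rcases hlab with hlt | ⟨heq, hlt⟩
      · refine h.rank_eq_of_le hi fun w hw => ?_
        obtain rfl : z' = w := by simpa using hw
        exact hlt
      · obtain ⟨rfl, hcov, ht, hl⟩ := increasingChain_cons_cons.1 h
        obtain ⟨-, -, p, q, d, hm, htight⟩ := hcov.exists_move
        have hlab := hc z' rfl
        rw [hm.flabel] at heq hlt
        simp only at heq hlt
        rw [ih ht (fun k => ?_) fun w hw => ?_, hm.rank_eq _ i hi, if_neg, add_zero]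
        · rintro ⟨h1, h2, -, -⟩
          rcases hi.lt_or_eq with hin | hin
          · have e := (hb ⟨i, hin⟩).2 rfl
            rcases h2.lt_or_eq with hiq | hiq
            · have := htight.between ⟨i, hin⟩ (Fin.lt_def.2 h1) hiq (by omega)
              omega
            · have := (hm.pos ⟨i, hin⟩).2 hiq
              omega
          · obtain ⟨k, hk⟩ := htight.occurs (le_antisymm hm.pos_le (by omega)) b (by omega) hlt
            have := (hb k).1 hk
            have := k.isLt
            omega
        · rw [← hb k, hm.eq k]
          have := hm.pos k
          have := hm.lt_val
          grind
        · exact pairLt_of_pairLt_of_pairLe hlab (hl w hw)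

theorem Move.eq_of_tight {x y y' : Fin n → ℕ} {p p' : Fin n} {q q' b : ℕ}
    (h : Move x y p q b) (h' : Move x y' p' q' b) (ht : Tight x p q b) (ht' : Tight x p' q' b)
    (hp : x p = x p') : y = y' := by
  have hq : q = q' := by
    by_contra hne
    have := h.pos_le
    have := h'.pos_le
    rcases lt_or_ge q n with hq | hq
    · exact hne ((h'.pos ⟨q, hq⟩).1 ((h.pos ⟨q, hq⟩).2 rfl))
    · exact hne ((h.pos ⟨q', by omega⟩).1 ((h'.pos ⟨q', by omega⟩).2 rfl)).symm
  subst hq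
  have hpp : p = p' := by
    have := h.lt_val
    rcases lt_trichotomy p p' with hlt | rfl | hlt
    · have := ht.between p' hlt h'.lt_pos hp.le
      omega
    · rfl
    · have := ht'.between p hlt h.lt_pos hp.ge
      omega
  subst hpp
  funext k
  rw [h.eq, h'.eq]

theorem IncreasingChain.not_pairLt {x y z z' : Fin n → ℕ} {s t : List (Fin n → ℕ)}
    (h : IncreasingChain x y (x :: z :: s)) (h' : IncreasingChain x y (x :: z' :: t)) :
    ¬ pairLt (Flabel x z) (Flabel x z') := by
  intro hlt
  obtain ⟨-, hcov, hs, -⟩ := increasingChain_cons_cons.1 h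
  obtain ⟨-, -, p, q, b, hm, -⟩ := hcov.exists_move
  have e := h'.rank_eq_of_pairLt hm.lt_val hm.pos_le hm.pos fun w hw => by
    obtain rfl : z' = w := by simpa using hw
    rwa [← hm.flabel]
  have f := hs.rookLe.rank_le (x p + 1) q hm.pos_le
  rw [hm.rank_eq _ q hm.pos_le, if_pos ⟨hm.lt_pos, le_rfl, Nat.lt_succ_self _, hm.lt_val⟩] at f
  omega

theorem RookCov.not_rookLe {x z : Fin n → ℕ} (h : RookCov n x z) : ¬ RookLe n z x := fun h' => by
  have := h.1.1.weight_lt h.1.2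
  have := h'.weight_le
  omega

theorem IncreasingChain.unique {x y : Fin n → ℕ} {c d : List (Fin n → ℕ)}
    (h : IncreasingChain x y c) (h' : IncreasingChain x y d) : c = d := by
  induction c generalizing x d with
  | nil => exact absurd h (increasingChain_nil x y)
  | cons u s ih =>
    rcases s with - | ⟨z, s⟩ <;> rcases d with - | ⟨v, - | ⟨z', t⟩⟩
    · exact absurd h' (increasingChain_nil x y)
    · rw [(increasingChain_singleton.1 h).1, (increasingChain_singleton.1 h').1]
    · obtain ⟨rfl, rfl⟩ := increasingChain_singleton.1 h
      obtain ⟨-, hc, ht, -⟩ := increasingChain_cons_cons.1 h'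
      exact absurd ht.rookLe hc.not_rookLe
    · exact absurd h' (increasingChain_nil x y)
    · obtain ⟨rfl, rfl⟩ := increasingChain_singleton.1 h'
      obtain ⟨-, hc, ht, -⟩ := increasingChain_cons_cons.1 h
      exact absurd ht.rookLe hc.not_rookLe
    · obtain ⟨rfl, hc, hs, -⟩ := increasingChain_cons_cons.1 h
      obtain ⟨rfl, hc', ht, -⟩ := increasingChain_cons_cons.1 h'
      have hlab : Flabel v z = Flabel v z' := by
        rcases pairLt_trichotomy (Flabel v z) (Flabel v z') with hlt | heq | hlt
        · exact absurd hlt (h.not_pairLt h')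
        · exact heq
        · exact absurd hlt (h'.not_pairLt h)
      obtain ⟨-, -, p, q, b, hm, htight⟩ := hc.exists_move
      obtain ⟨-, -, p', q', b', hm', htight'⟩ := hc'.exists_move
      rw [hm.flabel, hm'.flabel, Prod.mk.injEq] at hlab
      obtain ⟨hp, rfl⟩ := hlab
      obtain rfl := hm.eq_of_tight hm' htight htight' hp
      rw [ih hs ht]

theorem exists_increasingChain {x y : Fin n → ℕ} (h : RookLe n x y) :
    ∃ c, IncreasingChain x y c := by
  induction hN : weight y - weight x using Nat.strong_induction_on generalizing x with
  | _ N ih =>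
  by_cases hxy : x = y
  · exact ⟨[x], increasingChain_singleton.2 ⟨rfl, hxy⟩⟩
  obtain ⟨hx, v, p, q, b, hm, hv⟩ := h.head hxy
  obtain ⟨z₀, p₀, q₀, b₀, hm₀, ht₀, -, hz₀⟩ := hm.exists_tight hx
  obtain ⟨z, ⟨hcov, hzy⟩, hmin⟩ := (InvImage.wf (Flabel x) pairLt_wellFounded).has_min
    {z | RookCov n x z ∧ RookLe n z y} ⟨z₀, hm₀.cov ht₀ hx, hz₀.trans hv⟩
  have hlt := hcov.1.1.weight_lt hcov.1.2
  have hle := hzy.weight_le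
  obtain ⟨c, hc⟩ := ih _ (by omega) hzy rfl
  rcases c with - | ⟨u, t⟩
  · exact absurd hc (increasingChain_nil z y)
  obtain rfl : u = z := by simpa using hc.1.2.1
  refine ⟨x :: u :: t, increasingChain_cons_cons.2 ⟨rfl, hcov, hc, fun w hw => ?_⟩⟩
  obtain ⟨t, rfl⟩ : ∃ t', t = w :: t' := by
    cases t <;> simp_all
  obtain ⟨-, hcov', ht, -⟩ := increasingChain_cons_cons.1 hc
  rcases pairLt_trichotomy (Flabel x u) (Flabel u w) with hl | hl | hl
  · exact Or.inr hl
  · exact Or.inl hl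
  · exfalso
    obtain ⟨-, -, p, q, b, hm, -⟩ := hcov.exists_move
    obtain ⟨-, -, p', q', b', hm', -⟩ := hcov'.exists_move
    rw [hm.flabel, hm'.flabel] at hl
    obtain ⟨u', r, s, e, r', s', e', m1, m2, hlt⟩ := hm.exchange hx hm' hl
    obtain ⟨z', p₁, q₁, b₁, m3, ht₁, hle, hz'⟩ := m1.exists_tight hx
    refine hmin z' ⟨m3.cov ht₁ hx,
      (hz'.trans (m2.le (m1.isRook hx))).trans ht.rookLe⟩ ?_
    change pairLt (Flabel x z') (Flabel x u)
    rw [m3.flabel, hm.flabel]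
    exact pairLt_of_pairLe_of_pairLt hle hlt

theorem unique_increasing_chain (n : ℕ) (x y : Fin n → ℕ)
    (hx : IsRook n x) (hy : IsRook n y) (hle : RookLe n x y) :
    ∃! c : List (Fin n → ℕ), RookMaxChain n x y c ∧ (labels c).Chain' pairLe := by
  obtain ⟨c, hc⟩ := exists_increasingChain hle
  exact ⟨c, hc, fun d hd => IncreasingChain.unique hd hc⟩
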